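/- arXiv:2010.14868 — 8 statements merged into one kernel-verified Lean document; each statement's English description precedes it below -/
import Mathlib

section
/- Let ω = exp(2πi/3) and consider the four vectors in ℂ⁴ given as the rows of the matrix U₄: r₁ = ((1/2)√(2+√3), 0, 0, −(1/2)√(2−√3)), r₂ = ((1/6)√(6−3√3), 1/√3, 1/√3, (1/6)√(6+3√3)), r₃ = ((1/6)√(6−3√3), ω²/√3, ω/√3, (1/6)√(6+3√3)), r₄ = ((1/6)√(6−3√3), ω/√3, ω²/√3, (1/6)√(6+3√3)). Then (r₁, r₂, r₃, r₄) is an orthonormal basis of ℂ⁴; equivalently, U₄ is a unitary matrix. -/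
open scoped ComplexConjugate

noncomputable section

/-- The primitive third root of unity `ω = exp(2πi/3)`. -/
def ω : ℂ := Complex.exp (2 * Real.pi * Complex.I / 3)

/-- The Elegant Joint Measurement matrix `U₄`, whose rows are the two-qubit
basis with optimal single-sided distinguishability. -/
def U₄ : Matrix (Fin 4) (Fin 4) ℂ :=
  !![(((1 : ℝ) / 2) * Real.sqrt (2 + Real.sqrt 3) : ℝ), 0, 0,
      (-(((1 : ℝ) / 2) * Real.sqrt (2 - Real.sqrt 3)) : ℝ);
    ((((1 : ℝ) / 6) * Real.sqrt (6 - 3 * Real.sqrt 3) : ℝ) : ℂ),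
      (1 / (Real.sqrt 3 : ℂ)), (1 / (Real.sqrt 3 : ℂ)),
      ((((1 : ℝ) / 6) * Real.sqrt (6 + 3 * Real.sqrt 3) : ℝ) : ℂ);
    ((((1 : ℝ) / 6) * Real.sqrt (6 - 3 * Real.sqrt 3) : ℝ) : ℂ),
      (ω ^ 2 / (Real.sqrt 3 : ℂ)), (ω / (Real.sqrt 3 : ℂ)),
      ((((1 : ℝ) / 6) * Real.sqrt (6 + 3 * Real.sqrt 3) : ℝ) : ℂ);
    ((((1 : ℝ) / 6) * Real.sqrt (6 - 3 * Real.sqrt 3) : ℝ) : ℂ),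
      (ω / (Real.sqrt 3 : ℂ)), (ω ^ 2 / (Real.sqrt 3 : ℂ)),
      ((((1 : ℝ) / 6) * Real.sqrt (6 + 3 * Real.sqrt 3) : ℝ) : ℂ)]

theorem ω_isPrimitiveRoot : IsPrimitiveRoot ω 3 := by
  simpa [ω] using Complex.isPrimitiveRoot_exp 3 (by norm_num)

theorem ω_pow_three : ω ^ 3 = 1 := ω_isPrimitiveRoot.pow_eq_one

theorem one_add_ω_add_ω_sq : 1 + ω + ω ^ 2 = 0 := by
  simpa [Finset.sum_range_succ] using ω_isPrimitiveRoot.geom_sum_eq_zero (by norm_num)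

theorem conj_ω : conj ω = ω ^ 2 := by
  have hω : ω ≠ 0 := ω_isPrimitiveRoot.ne_zero (by norm_num)
  rw [← Complex.inv_eq_conj (ω_isPrimitiveRoot.norm'_eq_one (by norm_num))]
  field_simp
  exact ω_pow_three.symm

theorem sqrt_six_sub_three_mul_sqrt_three :
    √(6 - 3 * √3) = √3 * √(2 - √3) := by
  rw [← Real.sqrt_mul (by norm_num)]
  ring_nf

theorem sqrt_six_add_three_mul_sqrt_three :
    √(6 + 3 * √3) = √3 * √(2 + √3) := by
  rw [← Real.sqrt_mul (by norm_num)]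
  ring_nf

theorem sq_sqrt_two_add_sqrt_three_add_sq_sqrt_two_sub_sqrt_three :
    √(2 + √3) ^ 2 + √(2 - √3) ^ 2 = 4 := by
  have h : √3 ≤ 2 := Real.sqrt_le_iff.2 (by norm_num)
  rw [Real.sq_sqrt (by positivity), Real.sq_sqrt (by linarith)]
  ring

/-- The rows of `U₄` form an orthonormal basis of `ℂ⁴`;
equivalently, `U₄` is a unitary matrix. -/
theorem U₄_unitary : U₄ ∈ Matrix.unitaryGroup (Fin 4) ℂ := by
  have hab : ((√(2 + √3) : ℝ) : ℂ) ^ 2 + ((√(2 - √3) : ℝ) : ℂ) ^ 2 = 4 := mod_cast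
    sq_sqrt_two_add_sqrt_three_add_sq_sqrt_two_sub_sqrt_three
  have hs : ((√3 : ℝ) : ℂ) ^ 2 = 3 := mod_cast Real.sq_sqrt (by norm_num : (0 : ℝ) ≤ 3)
  have hs0 : ((√3 : ℝ) : ℂ) ≠ 0 := by
    intro h
    norm_num [h] at hs
  have hω := ω_pow_three
  have hω' := one_add_ω_add_ω_sq
  rw [Matrix.mem_unitaryGroup_iff, U₄, sqrt_six_sub_three_mul_sqrt_three,
    sqrt_six_add_three_mul_sqrt_three]
  ext i j
  fin_cases i <;> fin_cases j <;>
    simp [Matrix.mul_apply, Fin.sum_univ_four, conj_ω, map_ofNat] <;>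
    field_simp <;> grind

end
end

section
/- Let ω = exp(2πi/3) and let r₁, r₂, r₃, r₄ ∈ ℂ⁴ be the rows of the Elegant Joint Measurement matrix U₄: r₁ = ((1/2)√(2+√3), 0, 0, −(1/2)√(2−√3)), r₂ = ((1/6)√(6−3√3), 1/√3, 1/√3, (1/6)√(6+3√3)), r₃ = ((1/6)√(6−3√3), ω²/√3, ω/√3, (1/6)√(6+3√3)), r₄ = ((1/6)√(6−3√3), ω/√3, ω²/√3, (1/6)√(6+3√3)). Identify ℂ⁴ with functions Fin 2 × Fin 2 → ℂ via (a,b) ↦ 2a+b, and let ρ_i(a,b) = Σ_{k} r_i(a,k)·conj(r_i(b,k)) be the reduced 2×2 matrices. Then for all i ≠ j: trace(ρ_i − ρ_j) = 0 and det(ρ_i − ρ_j) = −1/2. (Hence ρ_i − ρ_j has eigenvalues ±1/√2 and the trace distance between any two distinct reduced states equals 1/√2, the value D_max for N = 2.) -/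
open scoped ComplexConjugate

noncomputable section

/-- The `i`-th row of `U₄`, viewed as a two-qubit state via `(a,b) ↦ 2a+b`. -/
def ejmState (i : Fin 4) (p : Fin 2 × Fin 2) : ℂ :=
  U₄ i ⟨2 * p.1.val + p.2.val, by omega⟩

/-- The reduced density matrix (partial trace over the second qubit) of the
`i`-th EJM basis state. -/
def ejmReduced (i : Fin 4) : Matrix (Fin 2) (Fin 2) ℂ :=
  Matrix.of fun a b => ∑ k, ejmState i (a, k) * conj (ejmState i (b, k))

theorem ω_sq_add_ω_add_one : ω ^ 2 + ω + 1 = 0 := by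
  have h : IsPrimitiveRoot ω 3 := by
    simpa [ω] using Complex.isPrimitiveRoot_exp 3 (by norm_num)
  have := h.geom_sum_eq_zero (by norm_num)
  simp only [Finset.sum_range_succ, Finset.sum_range_zero] at this
  linear_combination this

/-- The modulus `1/√6` of the coherence of the last three reduced states, as it arises from
the entries of `U₄`. -/
def ejmCoherence : ℝ :=
  (1 / 6 * √(6 - 3 * √3) + 1 / 6 * √(6 + 3 * √3)) / √3

theorem sqrt_three_lt_two : √3 < 2 := by
  rw [Real.sqrt_lt' (by norm_num)]
  norm_num

theorem ejmCoherence_sq : ejmCoherence ^ 2 = 1 / 6 := by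
  have h3 : √3 ^ 2 = 3 := Real.sq_sqrt (by norm_num)
  have hlt := sqrt_three_lt_two
  have hm : √(6 - 3 * √3) ^ 2 = 6 - 3 * √3 := Real.sq_sqrt (by linarith)
  have hp : √(6 + 3 * √3) ^ 2 = 6 + 3 * √3 := Real.sq_sqrt (by positivity)
  have hmp : √(6 - 3 * √3) * √(6 + 3 * √3) = 3 := by
    rw [← Real.sqrt_mul (by linarith), Real.sqrt_eq_iff_mul_self_eq (by nlinarith) (by norm_num)]
    linear_combination -9 * h3
  rw [ejmCoherence, div_pow, h3]
  linear_combination (hm + hp + 2 * hmp) / 108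

theorem ejmReduced_zero :
    ejmReduced 0 = !![(2 + (√3 : ℂ)) / 4, 0; 0, (2 - (√3 : ℂ)) / 4] := by
  have hp : (√(2 + √3) : ℂ) ^ 2 = 2 + √3 := by
    exact_mod_cast Real.sq_sqrt (by positivity)
  have hm : (√(2 - √3) : ℂ) ^ 2 = 2 - √3 := by
    exact_mod_cast Real.sq_sqrt (by linarith [sqrt_three_lt_two])
  ext a b
  fin_cases a <;> fin_cases b <;> simp [ejmReduced, ejmState, U₄, Complex.conj_ofNat]
  · linear_combination hp / 4
  · linear_combination hm / 4

/-- A two-qubit state with the amplitudes of one of the last three rows of `U₄`, where `ζ` is a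
phase, has populations independent of `ζ` and coherence proportional to `ζ`. -/
theorem ejmReduced_eq_of_row {i : Fin 4} {ζ : ℂ} (hζ : ζ * conj ζ = 1)
    (hi : U₄ i = ![((1 / 6 * √(6 - 3 * √3) : ℝ) : ℂ), ζ / (√3 : ℂ), conj ζ / (√3 : ℂ),
      ((1 / 6 * √(6 + 3 * √3) : ℝ) : ℂ)]) :
    ejmReduced i = !![(6 - (√3 : ℂ)) / 12, ejmCoherence * ζ;
      ejmCoherence * conj ζ, (6 + (√3 : ℂ)) / 12] := by
  have h3 : ((√3 : ℂ)⁻¹) ^ 2 = 1 / 3 := by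
    rw [inv_pow, ← Complex.ofReal_pow, Real.sq_sqrt (by norm_num)]
    norm_num
  have hm : (√(6 - 3 * √3) : ℂ) ^ 2 = 6 - 3 * √3 := by
    exact_mod_cast Real.sq_sqrt (by linarith [sqrt_three_lt_two])
  have hp : (√(6 + 3 * √3) : ℂ) ^ 2 = 6 + 3 * √3 := by
    exact_mod_cast Real.sq_sqrt (by positivity)
  ext a b
  fin_cases a <;> fin_cases b <;>
    simp [ejmReduced, ejmState, hi, ejmCoherence, div_eq_mul_inv, Complex.conj_ofNat]
  · linear_combination hm / 36 + ζ * conj ζ * h3 + hζ / 3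
  · ring
  · ring
  · linear_combination hp / 36 + ζ * conj ζ * h3 + hζ / 3

theorem ejmReduced_one :
    ejmReduced 1 = !![(6 - (√3 : ℂ)) / 12, ejmCoherence;
      ejmCoherence, (6 + (√3 : ℂ)) / 12] := by
  simpa using ejmReduced_eq_of_row (i := 1) (ζ := 1) (by simp) (by rw [map_one]; rfl)

theorem ejmReduced_two :
    ejmReduced 2 = !![(6 - (√3 : ℂ)) / 12, ejmCoherence * ω ^ 2;
      ejmCoherence * ω, (6 + (√3 : ℂ)) / 12] := by
  have h : conj (ω ^ 2) = ω := by rw [← conj_ω, Complex.conj_conj]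
  have := ejmReduced_eq_of_row (i := 2) (ζ := ω ^ 2)
    (by rw [h]; linear_combination ω_pow_three) (by rw [h]; rfl)
  rwa [h] at this

theorem ejmReduced_three :
    ejmReduced 3 = !![(6 - (√3 : ℂ)) / 12, ejmCoherence * ω;
      ejmCoherence * ω ^ 2, (6 + (√3 : ℂ)) / 12] := by
  have := ejmReduced_eq_of_row (i := 3) (ζ := ω)
    (by rw [conj_ω]; linear_combination ω_pow_three) (by rw [conj_ω]; rfl)
  rwa [conj_ω] at this

theorem trace_ejmReduced (i : Fin 4) : (ejmReduced i).trace = 1 := by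
  fin_cases i <;>
    simp [Matrix.trace_fin_two, ejmReduced_zero, ejmReduced_one, ejmReduced_two,
      ejmReduced_three] <;> ring

theorem det_ejmReduced_sub_of_lt {i j : Fin 4} (hij : i < j) :
    (ejmReduced i - ejmReduced j).det = -(1 / 2) := by
  have h3 : (√3 : ℂ) ^ 2 = 3 := by exact_mod_cast Real.sq_sqrt (by norm_num)
  have hc : (ejmCoherence : ℂ) ^ 2 = 1 / 6 := by
    rw [← Complex.ofReal_pow, ejmCoherence_sq]
    norm_num
  have hω := ω_sq_add_ω_add_one
  have hω3 := ω_pow_three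
  fin_cases i <;> fin_cases j <;> first
    | exact absurd hij (by decide)
    | simp only [Fin.zero_eta, Fin.mk_one, Fin.reduceFinMk, ejmReduced_zero, ejmReduced_one,
        ejmReduced_two, ejmReduced_three, Matrix.det_fin_two, Matrix.sub_apply, Matrix.of_apply,
        Matrix.cons_val', Matrix.cons_val_zero, Matrix.cons_val_one, Matrix.cons_val_fin_one]
      grind

/-- For any two distinct EJM basis states, the difference of the
reduced density matrices is traceless and has determinant `−1/2`; hence the
trace distance between any two distinct reduced states equals `1/√2`. -/
theorem ejm_reduced_trace_distance (i j : Fin 4) (hij : i ≠ j) :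
    Matrix.trace (ejmReduced i - ejmReduced j) = 0 ∧
    Matrix.det (ejmReduced i - ejmReduced j) = (-(1 / 2) : ℂ) := by
  refine ⟨by rw [Matrix.trace_sub, trace_ejmReduced, trace_ejmReduced, sub_self], ?_⟩
  rcases lt_or_gt_of_ne hij with h | h
  · exact det_ejmReduced_sub_of_lt h
  · rw [← neg_sub, Matrix.det_neg, det_ejmReduced_sub_of_lt h]
    norm_num

end
end

section
/- Let ω = exp(2πi/3). Consider the four qubit SIC vectors |1₀⟩ = (1,0), |2₀⟩ = (1/√3)(1,√2), |3₀⟩ = (1/√3)(1, ω√2), |4₀⟩ = (1/√3)(1, ω²√2) in ℂ², and the dual vectors |1₁⟩ = (0,1), |2₁⟩ = (1/√3)(√2,−1), |3₁⟩ = (1/√3)(√2,−ω), |4₁⟩ = (1/√3)(√2,−ω²), which satisfy ⟨i₀|i₁⟩ = 0. For λ ∈ [0,1] and phases φ₁, φ₂, φ₃, φ₄ ∈ ℝ define ψ_i ∈ ℂ^(2×2) by ψ_i(a,b) = √λ·(i₀)(a)·conj((i₀)(b)) + exp(i·φ_i)·√(1−λ)·(i₁)(a)·conj((i₁)(b)).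 If ⟨ψ_i, ψ_j⟩ = 0 for all i ≠ j, then λ·(1−λ) ≥ 1/16. -/
open scoped ComplexConjugate

noncomputable section

/-- The four qubit SIC vectors forming a tetrahedron in the Bloch sphere. -/
def sic (i : Fin 4) : Fin 2 → ℂ :=
  ![![1, 0],
    ![((1 / Real.sqrt 3 : ℝ) : ℂ), ((Real.sqrt 2 / Real.sqrt 3 : ℝ) : ℂ)],
    ![((1 / Real.sqrt 3 : ℝ) : ℂ), ω * ((Real.sqrt 2 / Real.sqrt 3 : ℝ) : ℂ)],
    ![((1 / Real.sqrt 3 : ℝ) : ℂ), ω ^ 2 * ((Real.sqrt 2 / Real.sqrt 3 : ℝ) : ℂ)]] i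

/-- The dual qubit SIC vectors, orthogonal to the corresponding `sic i`. -/
def sicDual (i : Fin 4) : Fin 2 → ℂ :=
  ![![0, 1],
    ![((Real.sqrt 2 / Real.sqrt 3 : ℝ) : ℂ), -((1 / Real.sqrt 3 : ℝ) : ℂ)],
    ![((Real.sqrt 2 / Real.sqrt 3 : ℝ) : ℂ), -(ω * ((1 / Real.sqrt 3 : ℝ) : ℂ))],
    ![((Real.sqrt 2 / Real.sqrt 3 : ℝ) : ℂ), -(ω ^ 2 * ((1 / Real.sqrt 3 : ℝ) : ℂ))]] i

/-- The locally tetrahedral two-qubit family with Schmidt coefficient `λ`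
and phases `φ i`. -/
def tetraState (lam : ℝ) (φ : Fin 4 → ℝ) (i : Fin 4) (p : Fin 2 × Fin 2) : ℂ :=
  (Real.sqrt lam : ℂ) * (sic i p.1 * conj (sic i p.2)) +
    Complex.exp (Complex.I * (φ i : ℂ)) * (Real.sqrt (1 - lam) : ℂ) *
      (sicDual i p.1 * conj (sicDual i p.2))

/-- The overlap of the first two tetrahedral states, in terms of their phases. -/
lemma tetraState_overlap (lam : ℝ) (φ : Fin 4 → ℝ) :
    3 * ∑ a : Fin 2, ∑ b : Fin 2,
        conj (tetraState lam φ 0 (a, b)) * tetraState lam φ 1 (a, b) =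
      (Real.sqrt lam : ℂ) ^ 2 +
        2 * ((Real.sqrt lam : ℂ) * (Real.sqrt (1 - lam) : ℂ)) *
          (Complex.exp (Complex.I * (φ 1 : ℂ)) + conj (Complex.exp (Complex.I * (φ 0 : ℂ)))) +
        (Real.sqrt (1 - lam) : ℂ) ^ 2 *
          (Complex.exp (Complex.I * (φ 1 : ℂ)) * conj (Complex.exp (Complex.I * (φ 0 : ℂ)))) := by
  have h₃ : ((Real.sqrt 3 : ℝ) : ℂ) ^ 2 = 3 := by
    exact_mod_cast Real.sq_sqrt (by norm_num : (0 : ℝ) ≤ 3)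
  have h₂ : ((Real.sqrt 2 : ℝ) : ℂ) ^ 2 = 2 := by
    exact_mod_cast Real.sq_sqrt (by norm_num : (0 : ℝ) ≤ 2)
  have h₀ : ((Real.sqrt 3 : ℝ) : ℂ) ≠ 0 := by
    intro h
    simp [h] at h₃
  generalize hz : Complex.exp (Complex.I * (φ 0 : ℂ)) = z
  generalize hw : Complex.exp (Complex.I * (φ 1 : ℂ)) = w
  simp only [Fin.sum_univ_two, tetraState, sic, sicDual, hz, hw]
  simp only [Matrix.cons_val_zero, Matrix.cons_val_one, map_mul, map_neg, map_zero,
    map_one, map_div₀, mul_zero, zero_mul, add_zero, zero_add, mul_one,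
    Complex.conj_ofReal, Complex.ofReal_div, Complex.ofReal_one]
  field_simp
  simp only [h₃, h₂]
  ring

/-- Comparing the relation with its complex conjugate gives `(l - m) * (z - w) = 0`. -/
lemma eq_or_eq_of_unit_relation {l m s : ℝ} {z w : ℂ} (hz : z * conj z = 1) (hw : w * conj w = 1)
    (h : (l : ℂ) + 2 * s * (w + conj z) + m * (w * conj z) = 0) : l = m ∨ z = w := by
  have hc := congrArg conj h
  simp only [map_add, map_mul, Complex.conj_ofReal, Complex.conj_conj, map_zero,
    map_ofNat] at hc
  have key : ((l : ℂ) - m) * (z - w) = 0 := by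
    linear_combination z * h - w * hc - (2 * s + m * w) * hz + (2 * s + m * z) * hw
  rcases mul_eq_zero.mp key with h' | h'
  · exact Or.inl (by exact_mod_cast sub_eq_zero.mp h')
  · exact Or.inr (sub_eq_zero.mp h')

/-- If the locally tetrahedral two-qubit states are pairwise
orthogonal, then the Schmidt coefficient satisfies `λ(1−λ) ≥ 1/16`. -/
theorem tetra_orthogonality_bound (lam : ℝ) (hlam : lam ∈ Set.Icc (0 : ℝ) 1)
    (φ : Fin 4 → ℝ)
    (horth : ∀ i j : Fin 4, i ≠ j →
      ∑ a : Fin 2, ∑ b : Fin 2,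
        conj (tetraState lam φ i (a, b)) * tetraState lam φ j (a, b) = 0) :
    lam * (1 - lam) ≥ 1 / 16 := by
  obtain ⟨h0, h1⟩ := hlam
  have horth₀₁ := tetraState_overlap lam φ
  rw [horth 0 1 (by decide), mul_zero] at horth₀₁
  have unit (x : ℝ) : Complex.exp (Complex.I * x) * conj (Complex.exp (Complex.I * x)) = 1 := by
    rw [Complex.mul_conj, Complex.normSq_eq_norm_sq, mul_comm Complex.I,
      Complex.norm_exp_ofReal_mul_I]
    norm_num
  have hz := unit (φ 0)
  have hw := unit (φ 1)
  generalize Complex.exp (Complex.I * (φ 0 : ℂ)) = z at *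
  generalize Complex.exp (Complex.I * (φ 1 : ℂ)) = w at *
  have hs : (Real.sqrt lam * Real.sqrt (1 - lam)) ^ 2 = lam * (1 - lam) := by
    rw [mul_pow, Real.sq_sqrt h0, Real.sq_sqrt (by linarith)]
  rw [← Complex.ofReal_pow, ← Complex.ofReal_pow, Real.sq_sqrt h0,
    Real.sq_sqrt (by linarith), ← Complex.ofReal_mul] at horth₀₁
  generalize Real.sqrt lam * Real.sqrt (1 - lam) = s at *
  rcases eq_or_eq_of_unit_relation hz hw horth₀₁.symm with h | rfl
  · have : lam = 1 / 2 := by linarith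
    subst this
    norm_num
  · rw [hz, Complex.add_conj] at horth₀₁
    have hre : 0 = lam + 2 * s * (2 * z.re) + (1 - lam) := by
      rw [mul_one] at horth₀₁
      exact_mod_cast horth₀₁
    have hn : z.re ^ 2 ≤ 1 := by
      rw [Complex.mul_conj] at hz
      have : Complex.normSq z = 1 := by exact_mod_cast hz
      rw [Complex.normSq_apply] at this
      nlinarith [sq_nonneg z.im]
    have hsr : 16 * (s ^ 2 * z.re ^ 2) = 1 := by
      have : 4 * (s * z.re) = -1 := by linarith
      linear_combination (4 * (s * z.re) - 1) * this
    nlinarith [mul_le_mul_of_nonneg_left hn (sq_nonneg s)]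

end
end

section
/- Let ω₆ = exp(iπ/3) and consider the four vectors in ℂ⁴ given by the rows of the matrix U'₄ = (1/(2√3))·[[√6, 0, 0, √6·ω₆⁴], [√2, 2ω₆², 2ω₆², √2·ω₆], [√2, 2, 2ω₆⁴, √2·ω₆], [√2, 2ω₆⁴, 2, √2·ω₆]]. Then these four vectors form an orthonormal basis of ℂ⁴, and moreover, identifying ℂ⁴ with functions Fin 2 × Fin 2 → ℂ via (a,b) ↦ 2a+b, every row r satisfies that both reduced 2×2 matrices — with entries Σ_k r(a,k)·conj(r(b,k)) and Σ_k r(k,a)·conj(r(k,b)) respectively — equal (1/2)·I. That is, U'₄ is a maximally entangled two-qubit basis: all single-party reductions are maximally mixed. -/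
open scoped ComplexConjugate

noncomputable section

/-- The primitive sixth root of unity `ω₆ = exp(iπ/3)`. -/
def ω₆ : ℂ := Complex.exp (Real.pi * Complex.I / 3)

/-- The maximally entangled two-qubit basis `U'₄` (λ = 1/2, φ = π/3). -/
def U₄' : Matrix (Fin 4) (Fin 4) ℂ :=
  (1 / (2 * ((Real.sqrt 3 : ℝ) : ℂ))) •
    !![((Real.sqrt 6 : ℝ) : ℂ), 0, 0, ((Real.sqrt 6 : ℝ) : ℂ) * ω₆ ^ 4;
      ((Real.sqrt 2 : ℝ) : ℂ), 2 * ω₆ ^ 2, 2 * ω₆ ^ 2, ((Real.sqrt 2 : ℝ) : ℂ) * ω₆;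
      ((Real.sqrt 2 : ℝ) : ℂ), 2, 2 * ω₆ ^ 4, ((Real.sqrt 2 : ℝ) : ℂ) * ω₆;
      ((Real.sqrt 2 : ℝ) : ℂ), 2 * ω₆ ^ 4, 2, ((Real.sqrt 2 : ℝ) : ℂ) * ω₆]

/-- The `i`-th row of `U₄'`, viewed as a two-qubit state via `(a,b) ↦ 2a+b`. -/
def row₄' (i : Fin 4) (p : Fin 2 × Fin 2) : ℂ :=
  U₄' i ⟨2 * p.1.val + p.2.val, by omega⟩

theorem ω₆_eq : ω₆ = 1 / 2 + (Real.sqrt 3 : ℂ) / 2 * Complex.I := by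
  have h : (Real.pi : ℂ) * Complex.I / 3 = ((Real.pi / 3 : ℝ) : ℂ) * Complex.I := by
    push_cast
    ring
  rw [ω₆, h, Complex.exp_mul_I, ← Complex.ofReal_cos, ← Complex.ofReal_sin,
    Real.cos_pi_div_three, Real.sin_pi_div_three]
  push_cast
  ring

theorem conj_ω₆ : conj ω₆ = 1 - ω₆ := by
  simp only [ω₆_eq, map_add, map_mul, map_div₀, map_one, map_ofNat, Complex.conj_I,
    Complex.conj_ofReal]
  ring

theorem sq_ofReal_sqrt {x : ℝ} (hx : 0 ≤ x) : ((Real.sqrt x : ℝ) : ℂ) ^ 2 = x := by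
  rw [← Complex.ofReal_pow, Real.sq_sqrt hx]

theorem ω₆_sq : ω₆ ^ 2 = ω₆ - 1 := by
  have h3 : ((Real.sqrt 3 : ℝ) : ℂ) ^ 2 = 3 := by simpa using sq_ofReal_sqrt (x := 3) (by norm_num)
  rw [ω₆_eq]
  linear_combination (1 / 4 : ℂ) * Complex.I ^ 2 * h3 + (3 / 4 : ℂ) * Complex.I_sq

theorem ω₆_pow_four : ω₆ ^ 4 = -ω₆ := by
  linear_combination (ω₆ ^ 2 + ω₆) * ω₆_sq

/-- The rows of `U₄'` form an orthonormal basis of `ℂ⁴`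
(equivalently `U₄'` is unitary) and every row is maximally entangled:
both single-party reductions equal `(1/2)·I`. -/
theorem U₄'_maximally_entangled_basis :
    U₄' ∈ Matrix.unitaryGroup (Fin 4) ℂ ∧
    ∀ i : Fin 4,
      (Matrix.of fun a b => ∑ k, row₄' i (a, k) * conj (row₄' i (b, k))) =
        ((1 / 2 : ℂ) • (1 : Matrix (Fin 2) (Fin 2) ℂ)) ∧
      (Matrix.of fun a b => ∑ k, row₄' i (k, a) * conj (row₄' i (k, b))) =
        ((1 / 2 : ℂ) • (1 : Matrix (Fin 2) (Fin 2) ℂ)) := by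
  have hω := ω₆_sq
  have h2 : ((Real.sqrt 2 : ℝ) : ℂ) ^ 2 = 2 := by simpa using sq_ofReal_sqrt (x := 2) (by norm_num)
  have h3 : ((Real.sqrt 3 : ℝ) : ℂ) ^ 2 = 3 := by simpa using sq_ofReal_sqrt (x := 3) (by norm_num)
  have h6 : ((Real.sqrt 6 : ℝ) : ℂ) = (Real.sqrt 2 : ℝ) * (Real.sqrt 3 : ℝ) := by
    rw [← Complex.ofReal_mul, ← Real.sqrt_mul (by norm_num)]
    norm_num
  have h3_inv : ((Real.sqrt 3 : ℝ) : ℂ)⁻¹ = (Real.sqrt 3 : ℝ) / 3 := by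
    have h0 : ((Real.sqrt 3 : ℝ) : ℂ) ≠ 0 := by simp
    field_simp
    exact h3.symm
  refine ⟨?_, fun i => ⟨?_, ?_⟩⟩
  · rw [Matrix.mem_unitaryGroup_iff]
    ext i j
    fin_cases i <;> fin_cases j <;>
      simp [U₄', Matrix.mul_apply, Fin.sum_univ_four, Matrix.star_apply, conj_ω₆, ω₆_sq,
        ω₆_pow_four, h6, h3_inv, Complex.conj_ofNat] <;> grind
  all_goals
    ext a b
    fin_cases i <;> fin_cases a <;> fin_cases b <;>
      simp [row₄', U₄', Fin.sum_univ_two, conj_ω₆, ω₆_sq, ω₆_pow_four,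
        h6, h3_inv, Complex.conj_ofNat] <;> grind

end
end

section
/- Let ω = exp(2πi/3). The 9×9 matrix U₉sym = (1/(3√3))·M, where the rows of M are: (−1,0,0,0,2,−3,0,−3,2), (−1,0,0,0,2,−3ω²,0,−3ω,2), (−1,0,0,0,2,−3ω,0,−3ω²,2), (2,0,−3,0,−1,0,−3,0,2), (2,0,−3ω²,0,−1,0,−3ω,0,2), (2,0,−3ω,0,−1,0,−3ω²,0,2), (2,−3,0,−3,2,0,0,0,−1), (2,−3ω²,0,−3ω,2,0,0,0,−1), (2,−3ω,0,−3ω²,2,0,0,0,−1), is a unitary matrix; equivalently its rows form an orthonormal basis of ℂ⁹. -/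
open scoped ComplexConjugate

noncomputable section

/-- The symmetric form `U₉sym` of the two-qutrit basis with optimal
single-sided distinguishability. -/
def U₉sym : Matrix (Fin 9) (Fin 9) ℂ :=
  (1 / (3 * ((Real.sqrt 3 : ℝ) : ℂ))) •
    !![-1, 0, 0, 0, 2, -3, 0, -3, 2;
      -1, 0, 0, 0, 2, -3 * ω ^ 2, 0, -3 * ω, 2;
      -1, 0, 0, 0, 2, -3 * ω, 0, -3 * ω ^ 2, 2;
      2, 0, -3, 0, -1, 0, -3, 0, 2;
      2, 0, -3 * ω ^ 2, 0, -1, 0, -3 * ω, 0, 2;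
      2, 0, -3 * ω, 0, -1, 0, -3 * ω ^ 2, 0, 2;
      2, -3, 0, -3, 2, 0, 0, 0, -1;
      2, -3 * ω ^ 2, 0, -3 * ω, 2, 0, 0, 0, -1;
      2, -3 * ω, 0, -3 * ω ^ 2, 2, 0, 0, 0, -1]

theorem normalization_mul_conj :
    (1 / (3 * ((Real.sqrt 3 : ℝ) : ℂ))) * conj (1 / (3 * ((Real.sqrt 3 : ℝ) : ℂ))) = 1 / 27 := by
  have hsqrt : ((Real.sqrt 3 : ℝ) : ℂ) * ((Real.sqrt 3 : ℝ) : ℂ) = 3 := by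
    rw [← Complex.ofReal_mul, Real.mul_self_sqrt (by norm_num)]
    norm_num
  rw [map_div₀, map_mul, map_one, Complex.conj_ofReal, Complex.conj_ofNat, div_mul_div_comm,
    mul_mul_mul_comm, hsqrt]
  norm_num

set_option maxHeartbeats 2000000 in
/-- `U₉sym` is a unitary matrix; equivalently its rows form an
orthonormal basis of `ℂ⁹`. -/
theorem U₉sym_unitary : U₉sym ∈ Matrix.unitaryGroup (Fin 9) ℂ := by
  rw [Matrix.mem_unitaryGroup_iff, U₉sym, star_smul, smul_mul_smul_comm, ← starRingEnd_apply,
    normalization_mul_conj, Matrix.star_eq_conjTranspose]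
  have hsq : ω ^ 2 = -1 - ω := by linear_combination one_add_ω_add_ω_sq
  have hconj : conj ω = -1 - ω := conj_ω.trans hsq
  ext i j
  simp only [Matrix.smul_apply, Matrix.mul_apply, Matrix.conjTranspose_apply,
    Fin.sum_univ_castSucc (n := 8), Fin.sum_univ_eight]
  fin_cases i <;> fin_cases j <;>
    simp [hsq, hconj] <;>
    grind

end
end

section
/- Let ω = exp(2πi/3) and let M be the 9×9 matrix M = (1/(2√3))·A with rows of A given by: (2,0,0,0,−2,0,0,0,−2), (−1,−i√3,0,i√3,1,0,0,0,−2), (−1,i√3,0,−i√3,1,0,0,0,−2), (−1,1,√2,1,−1,√2,√2,√2,0), (−1,1,√2ω²,1,−1,√2ω²,√2ω,√2ω,0), (−1,1,√2ω,1,−1,√2ω,√2ω²,√2ω²,0), (−1,−1,√2,−1,−1,−√2,√2,−√2,0), (−1,−1,√2ω,−1,−1,−√2ω,√2ω²,−√2ω²,0), (−1,−1,√2ω²,−1,−1,−√2ω²,√2ω,−√2ω,0). Index rows and columns of M by pairs (i,j) ∈ Fin 3 × Fin 3 via 3i+j. Then M is 2-unitary: M is unitary, the realignment M^R defined by M^R_{(i,j),(k,l)}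 = M_{(i,k),(j,l)} is unitary, and the partial transpose M^Γ defined by M^Γ_{(i,j),(k,l)} = M_{(i,l),(k,j)} is unitary. -/
open scoped ComplexConjugate

noncomputable section

/-- Abbreviation for `√2` as a complex number. -/
def s2 : ℂ := ((Real.sqrt 2 : ℝ) : ℂ)

/-- Abbreviation for `i√3` as a complex number. -/
def is3 : ℂ := Complex.I * ((Real.sqrt 3 : ℝ) : ℂ)

/-- The permuted maximally entangled two-qutrit basis, as a 9×9 matrix. -/
def A₉ : Matrix (Fin 9) (Fin 9) ℂ :=
  (1 / (2 * ((Real.sqrt 3 : ℝ) : ℂ))) •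
    !![2, 0, 0, 0, -2, 0, 0, 0, -2;
      -1, -is3, 0, is3, 1, 0, 0, 0, -2;
      -1, is3, 0, -is3, 1, 0, 0, 0, -2;
      -1, 1, s2, 1, -1, s2, s2, s2, 0;
      -1, 1, s2 * ω ^ 2, 1, -1, s2 * ω ^ 2, s2 * ω, s2 * ω, 0;
      -1, 1, s2 * ω, 1, -1, s2 * ω, s2 * ω ^ 2, s2 * ω ^ 2, 0;
      -1, -1, s2, -1, -1, -s2, s2, -s2, 0;
      -1, -1, s2 * ω, -1, -1, -(s2 * ω), s2 * ω ^ 2, -(s2 * ω ^ 2), 0;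
      -1, -1, s2 * ω ^ 2, -1, -1, -(s2 * ω ^ 2), s2 * ω, -(s2 * ω), 0]

/-- The same matrix indexed by pairs `(i,j) ∈ Fin 3 × Fin 3` via `3i+j`. -/
def M₉ : Matrix (Fin 3 × Fin 3) (Fin 3 × Fin 3) ℂ :=
  Matrix.of fun p q =>
    A₉ ⟨3 * p.1.val + p.2.val, by omega⟩ ⟨3 * q.1.val + q.2.val, by omega⟩

lemma s2_sq : s2 ^ 2 = 2 := by
  rw [s2, ← Complex.ofReal_pow, Real.sq_sqrt (by norm_num)]
  norm_num

lemma is3_sq : is3 ^ 2 = -3 := by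
  rw [is3, mul_pow, Complex.I_sq, ← Complex.ofReal_pow, Real.sq_sqrt (by norm_num)]
  norm_num

lemma conj_s2 : conj s2 = s2 := Complex.conj_ofReal _

lemma conj_is3 : conj is3 = -is3 := by
  simp [is3]

lemma ω_eq : ω = (-1 + is3) / 2 := by
  have h : (2 * Real.pi * Complex.I / 3 : ℂ) = ((Real.pi - Real.pi / 3 : ℝ) : ℂ) * Complex.I := by
    push_cast
    ring
  rw [ω, h, Complex.exp_mul_I, ← Complex.ofReal_cos, ← Complex.ofReal_sin, Real.cos_pi_sub,
    Real.sin_pi_sub, Real.cos_pi_div_three, Real.sin_pi_div_three, is3]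
  push_cast
  ring

lemma ω_sq : ω ^ 2 = (-1 - is3) / 2 := by
  rw [ω_eq]
  linear_combination is3_sq / 4

lemma sqrt_three_mul_self : ((Real.sqrt 3 : ℝ) : ℂ) * ((Real.sqrt 3 : ℝ) : ℂ) = 3 := by
  rw [← Complex.ofReal_mul, Real.mul_self_sqrt (by norm_num)]
  norm_num

/-- The matrix `2√3 • M₉`, with its entries written in terms of `√2` and `i√3` only. -/
def B₉ : Fin 3 → Fin 3 → Fin 3 → Fin 3 → ℂ :=
  ![![![![2, 0, 0], ![0, -2, 0], ![0, 0, -2]],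
       ![![-1, -is3, 0], ![is3, 1, 0], ![0, 0, -2]],
       ![![-1, is3, 0], ![-is3, 1, 0], ![0, 0, -2]]],
     ![![![-1, 1, s2], ![1, -1, s2], ![s2, s2, 0]],
       ![![-1, 1, s2 * ((-1 - is3) / 2)], ![1, -1, s2 * ((-1 - is3) / 2)],
         ![s2 * ((-1 + is3) / 2), s2 * ((-1 + is3) / 2), 0]],
       ![![-1, 1, s2 * ((-1 + is3) / 2)], ![1, -1, s2 * ((-1 + is3) / 2)],
         ![s2 * ((-1 - is3) / 2), s2 * ((-1 - is3) / 2), 0]]],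
     ![![![-1, -1, s2], ![-1, -1, -s2], ![s2, -s2, 0]],
       ![![-1, -1, s2 * ((-1 + is3) / 2)], ![-1, -1, -(s2 * ((-1 + is3) / 2))],
         ![s2 * ((-1 - is3) / 2), -(s2 * ((-1 - is3) / 2)), 0]],
       ![![-1, -1, s2 * ((-1 - is3) / 2)], ![-1, -1, -(s2 * ((-1 - is3) / 2))],
         ![s2 * ((-1 + is3) / 2), -(s2 * ((-1 + is3) / 2)), 0]]]]

lemma M₉_apply (i j k l : Fin 3) :
    M₉ (i, j) (k, l) = 1 / (2 * ((Real.sqrt 3 : ℝ) : ℂ)) * B₉ i j k l := by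
  rw [M₉, Matrix.of_apply, A₉, Matrix.smul_apply, smul_eq_mul, ω_sq, ω_eq]
  congr 1
  fin_cases i <;> fin_cases j <;> fin_cases k <;> fin_cases l <;> rfl

/-- A matrix is unitary if it is `1 / (2√3)` times a matrix with orthogonal rows of squared norm
`12`. -/
lemma mem_unitaryGroup_of_sum_eq (M : Matrix (Fin 3 × Fin 3) (Fin 3 × Fin 3) ℂ)
    (b : Fin 3 → Fin 3 → Fin 3 → Fin 3 → ℂ)
    (hM : ∀ i j k l, M (i, j) (k, l) = 1 / (2 * ((Real.sqrt 3 : ℝ) : ℂ)) * b i j k l)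
    (hb : ∀ i j m n, ∑ k, ∑ l, b i j k l * conj (b m n k l) =
      if i = m ∧ j = n then 12 else 0) :
    M ∈ Matrix.unitaryGroup (Fin 3 × Fin 3) ℂ := by
  have hc : 1 / (2 * ((Real.sqrt 3 : ℝ) : ℂ)) * (1 / (2 * ((Real.sqrt 3 : ℝ) : ℂ))) = 1 / 12 := by
    rw [div_mul_div_comm, mul_mul_mul_comm, sqrt_three_mul_self]
    norm_num
  rw [Matrix.mem_unitaryGroup_iff]
  ext ⟨i, j⟩ ⟨m, n⟩
  have hterm (k l : Fin 3) : M (i, j) (k, l) * star M (k, l) (m, n) =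
      1 / 12 * (b i j k l * conj (b m n k l)) := by
    rw [Matrix.star_apply, hM, hM, ← hc]
    simp only [Complex.star_def, map_mul, map_div₀, map_one, map_ofNat, Complex.conj_ofReal]
    ring
  rw [Matrix.mul_apply, Fintype.sum_prod_type]
  simp only [hterm, ← Finset.mul_sum, hb, Matrix.one_apply, Prod.mk.injEq]
  split_ifs <;> norm_num

set_option maxHeartbeats 2000000 in
lemma B₉_rows (i j m n : Fin 3) : ∑ k, ∑ l, B₉ i j k l * conj (B₉ m n k l) =
    if i = m ∧ j = n then 12 else 0 := by
  have h2 := s2_sq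
  have h3 := is3_sq
  fin_cases i <;> fin_cases j <;> fin_cases m <;> fin_cases n <;>
    simp [B₉, Fin.sum_univ_three, conj_s2, conj_is3, map_ofNat] <;> grind

set_option maxHeartbeats 2000000 in
lemma B₉_realign_rows (i j m n : Fin 3) : ∑ k, ∑ l, B₉ i k j l * conj (B₉ m k n l) =
    if i = m ∧ j = n then 12 else 0 := by
  have h2 := s2_sq
  have h3 := is3_sq
  fin_cases i <;> fin_cases j <;> fin_cases m <;> fin_cases n <;>
    simp [B₉, Fin.sum_univ_three, conj_s2, conj_is3, map_ofNat] <;> grind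

set_option maxHeartbeats 2000000 in
lemma B₉_partialTranspose_rows (i j m n : Fin 3) :
    ∑ k, ∑ l, B₉ i l k j * conj (B₉ m l k n) = if i = m ∧ j = n then 12 else 0 := by
  have h2 := s2_sq
  have h3 := is3_sq
  fin_cases i <;> fin_cases j <;> fin_cases m <;> fin_cases n <;>
    simp [B₉, Fin.sum_univ_three, conj_s2, conj_is3, map_ofNat] <;> grind

/-- `M₉` is 2-unitary: the matrix itself, its realignment
`M^R_{(i,j),(k,l)} = M_{(i,k),(j,l)}` and its partial transpose
`M^Γ_{(i,j),(k,l)} = M_{(i,l),(k,j)}` are all unitary. -/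
theorem M₉_two_unitary :
    M₉ ∈ Matrix.unitaryGroup (Fin 3 × Fin 3) ℂ ∧
    (Matrix.of fun (p q : Fin 3 × Fin 3) => M₉ (p.1, q.1) (p.2, q.2)) ∈
      Matrix.unitaryGroup (Fin 3 × Fin 3) ℂ ∧
    (Matrix.of fun (p q : Fin 3 × Fin 3) => M₉ (p.1, q.2) (q.1, p.2)) ∈
      Matrix.unitaryGroup (Fin 3 × Fin 3) ℂ := by
  exact ⟨mem_unitaryGroup_of_sum_eq _ B₉ M₉_apply B₉_rows,
    mem_unitaryGroup_of_sum_eq _ (fun i j k l => B₉ i k j l) (fun i j k l => M₉_apply i k j l)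
      B₉_realign_rows,
    mem_unitaryGroup_of_sum_eq _ (fun i j k l => B₉ i l k j) (fun i j k l => M₉_apply i l k j)
      B₉_partialTranspose_rows⟩

end
end

section
/- Let N ≥ 2 and let λ_max = (N³ − N² − N + 2(N−1)·√(N+1) + 2)/N³. Then λ_max ∈ [0,1] and the orthogonality identity holds: λ_max/(N+1) + ((1−λ_max)/(N−1))·(N − 2 + 1/(N+1)) = 2·√(λ_max·(1−λ_max)/(N−1))·(N/(N+1)). -/
/-- `λ_max ∈ [0,1]` and the key orthogonality identity
`λ/(N+1) + ((1−λ)/(N−1))·(N−2+1/(N+1)) = 2·√(λ(1−λ)/(N−1))·(N/(N+1))`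
holds for `λ = λ_max`. -/
theorem lambda_max_orthogonality_identity
    (N : ℕ) (hN : 2 ≤ N)
    (lmax : ℝ)
    (hlmax : lmax = ((N : ℝ) ^ 3 - N ^ 2 - N + 2 * ((N : ℝ) - 1) * Real.sqrt ((N : ℝ) + 1) + 2)
      / (N : ℝ) ^ 3) :
    lmax ∈ Set.Icc (0 : ℝ) 1 ∧
    lmax / ((N : ℝ) + 1) +
        ((1 - lmax) / ((N : ℝ) - 1)) * ((N : ℝ) - 2 + 1 / ((N : ℝ) + 1)) =
      2 * Real.sqrt (lmax * (1 - lmax) / ((N : ℝ) - 1)) * ((N : ℝ) / ((N : ℝ) + 1)) := by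
  have hN2 : (2 : ℝ) ≤ N := by exact_mod_cast hN
  obtain ⟨s, hs⟩ : ∃ s, s = Real.sqrt ((N : ℝ) + 1) := ⟨_, rfl⟩
  have hs_sq : s ^ 2 = (N : ℝ) + 1 := by rw [hs]; exact Real.sq_sqrt (by linarith)
  have hs_nonneg : 0 ≤ s := hs ▸ Real.sqrt_nonneg _
  rw [← hs] at hlmax
  have hN_eq : (N : ℝ) = s ^ 2 - 1 := by linarith
  generalize (N : ℝ) = n at *
  subst hN_eq
  have hn_pos : 0 < s ^ 2 - 1 := by linarith
  have hn_sub_pos : 0 < s ^ 2 - 1 - 1 := by linarith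
  have hl : lmax = (s ^ 2 + s - 1) ^ 2 / ((s ^ 2 - 1) * (s + 1) ^ 2) := by
    rw [hlmax, div_eq_div_iff (by positivity) (by positivity)]
    ring
  have hl_compl : 1 - lmax = (s ^ 2 - 1 - 1) / ((s ^ 2 - 1) * (s + 1) ^ 2) := by
    rw [hl, eq_div_iff (by positivity), sub_mul, div_mul_cancel₀ _ (by positivity)]
    ring
  have hl_nonneg : 0 ≤ lmax := by rw [hl]; positivity
  have hl_compl_nonneg : 0 ≤ 1 - lmax := by rw [hl_compl]; positivity
  refine ⟨⟨hl_nonneg, by linarith⟩, ?_⟩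
  have h_sqrt : Real.sqrt (lmax * (1 - lmax) / (s ^ 2 - 1 - 1))
      = (s ^ 2 + s - 1) / ((s ^ 2 - 1) * (s + 1) ^ 2) := by
    have h_num : 0 ≤ s ^ 2 + s - 1 := by linarith
    rw [Real.sqrt_eq_iff_mul_self_eq (by positivity) (by positivity), hl_compl, hl]
    field_simp
  rw [h_sqrt, hl_compl, hl]
  field_simp
  ring
end

section
/- Define λ_min(N) = (N³ − N² − N − 2(N−1)·√(N+1) + 2)/N³ for natural numbers N ≥ 2. Then λ_min(3) = 1/3, and for every N ≥ 4 one has λ_min(N) > 1/N. -/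
/-- The smallest admissible Schmidt coefficient
`λ_min(N) = (N³ − N² − N − 2(N−1)√(N+1) + 2)/N³`. -/
noncomputable def lambdaMin (N : ℕ) : ℝ :=
  ((N : ℝ) ^ 3 - (N : ℝ) ^ 2 - (N : ℝ) -
      2 * ((N : ℝ) - 1) * Real.sqrt ((N : ℝ) + 1) + 2) / (N : ℝ) ^ 3

/-- `λ_min(3) = 1/3`, and `λ_min(N) > 1/N` for every `N ≥ 4`:
a maximally entangled basis of this family exists for `N = 3` only. -/
theorem lambdaMin_eq_third_and_gt :
    lambdaMin 3 = 1 / 3 ∧ ∀ N : ℕ, 4 ≤ N → lambdaMin N > 1 / (N : ℝ) := by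
  refine ⟨?_, fun N hN => ?_⟩
  · have h : Real.sqrt ((3 : ℝ) + 1) = 2 := by
      rw [Real.sqrt_eq_iff_mul_self_eq] <;> norm_num
    simp only [lambdaMin, Nat.cast_ofNat, h]
    norm_num
  · have hx : (4 : ℝ) ≤ N := by exact_mod_cast hN
    unfold lambdaMin
    generalize (N : ℝ) = x at hx ⊢
    have hs : 2 < Real.sqrt (x + 1) := Real.lt_sqrt_of_sq_lt (by linarith)
    have hsq : Real.sqrt (x + 1) ^ 2 = x + 1 := Real.sq_sqrt (by linarith)
    generalize Real.sqrt (x + 1) = s at hs hsq ⊢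
    -- The numerator minus `x ^ 2` factors as `(x - 1) * s * (s * (x - 2) - 2)`.
    have hpos : 0 < (x - 1) * s * (s * (x - 2) - 2) :=
      mul_pos (mul_pos (by linarith) (by linarith)) (by nlinarith)
    rw [gt_iff_lt, div_lt_div_iff₀ (by linarith) (by positivity)]
    have hnum : x ^ 2 < x ^ 3 - x ^ 2 - x - 2 * (x - 1) * s + 2 := by
      linear_combination hpos + (x - 1) * (x - 2) * hsq
    nlinarith [mul_lt_mul_of_pos_right hnum (show 0 < x by linarith)]
end
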